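/- arXiv:0906.3192 — 7 statements merged into one kernel-verified Lean document; each statement's English description precedes it below -/
import Mathlib

section
/- Let N ≥ L ≥ 1 and let h, g ∈ ℂ^{L+1}. Suppose the polynomial S_g(z) = Σ_{i=0}^{L} g_i z^{L-i} has l pairwise distinct complex roots a_1, ..., a_l (1 ≤ l ≤ L), none of which is a root of S_h(z) = Σ_{i=0}^{L} h_i z^{L-i}. Then there exists a matrix V₁ ∈ ℂ^{(N+L)×l} with orthonormal columns (V₁^H V₁ = I_l) such that T(g) V₁ = 0_{N×l} and rank(T(h) V₁) = l. -/
open Matrix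

/-- The `N × (N+L)` Toeplitz channel matrix of an `L+1`-tap channel `h`:
`T(h)_{i,j} = h_{L-(j-i)}` if `0 ≤ j-i ≤ L`, and `0` otherwise. -/
noncomputable def toeplitzChannel (N L : ℕ) (h : Fin (L + 1) → ℂ) :
    Matrix (Fin N) (Fin (N + L)) ℂ :=
  Matrix.of fun i j =>
    if hij : (i : ℕ) ≤ (j : ℕ) ∧ (j : ℕ) - (i : ℕ) ≤ L then
      h ⟨L - ((j : ℕ) - (i : ℕ)), by omega⟩
    else 0

/-- The channel polynomial `S_h(z) = ∑_{i=0}^{L} h_i z^{L-i}`. -/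
noncomputable def channelPoly (L : ℕ) (h : Fin (L + 1) → ℂ) (z : ℂ) : ℂ :=
  ∑ i : Fin (L + 1), h i * z ^ (L - (i : ℕ))

/-- Applied to a geometric progression `z ^ j`, the Toeplitz channel matrix returns the geometric
progression scaled by the value of the channel polynomial. -/
lemma sum_toeplitzChannel_mul_pow (N L : ℕ) (h : Fin (L + 1) → ℂ) (z : ℂ) (i : Fin N) :
    ∑ j, toeplitzChannel N L h i j * z ^ (j : ℕ) = channelPoly L h z * z ^ (i : ℕ) := by
  rw [channelPoly, Finset.sum_mul]
  symm
  refine Fintype.sum_of_injective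
    (fun p : Fin (L + 1) => (⟨i + (L - p), by omega⟩ : Fin (N + L))) ?_ _ _ ?_ ?_
  · intro p q hpq
    simp only [Fin.mk.injEq] at hpq
    ext
    omega
  · intro j hj
    have hij : ¬((i : ℕ) ≤ j ∧ (j : ℕ) - i ≤ L) := fun hij =>
      hj ⟨⟨L - (j - i), by omega⟩, by ext; simp only; omega⟩
    simp only [toeplitzChannel, of_apply, dif_neg hij, zero_mul]
  · intro p
    have hp : L - (L - (p : ℕ)) = p := by omega
    have hpL : (i : ℕ) ≤ i + (L - p) ∧ i + (L - (p : ℕ)) - i ≤ L := by omega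
    rw [toeplitzChannel, of_apply, dif_pos hpL]
    simp only [Nat.add_sub_cancel_left, hp, pow_add]
    ring

open scoped ComplexOrder in
/-- A complex matrix with trivial kernel can be given orthonormal columns by multiplying it on the
right by an invertible matrix. -/
lemma exists_isUnit_det_conjTranspose_mul_self_eq_one {m n : Type*} [Fintype m] [Fintype n]
    [DecidableEq n] (W : Matrix m n ℂ) (hW : Function.Injective W.mulVec) :
    ∃ B : Matrix n n ℂ, IsUnit B.det ∧ (W * B)ᴴ * (W * B) = 1 := by
  have hG : (Wᴴ * W).PosDef := PosDef.conjTranspose_mul_self W hW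
  obtain ⟨C, hC⟩ : ∃ C : Matrix n n ℂ, Wᴴ * W = Cᴴ * C := by
    open scoped MatrixOrder Matrix.Norms.L2Operator in
    exact CStarAlgebra.nonneg_iff_eq_star_mul_self.mp hG.posSemidef.nonneg
  have hCdet : IsUnit C.det := by
    have hdet := hG.det_pos.ne'
    rw [hC, det_mul] at hdet
    exact isUnit_iff_ne_zero.mpr (right_ne_zero_of_mul hdet)
  refine ⟨C⁻¹, C.isUnit_nonsing_inv_det hCdet, ?_⟩
  calc (W * C⁻¹)ᴴ * (W * C⁻¹) = C⁻¹ᴴ * (Wᴴ * W) * C⁻¹ := by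
        simp only [conjTranspose_mul, Matrix.mul_assoc]
    _ = (C * C⁻¹)ᴴ * (C * C⁻¹) := by
        rw [hC]
        simp only [conjTranspose_mul, Matrix.mul_assoc]
    _ = 1 := by simp [mul_nonsing_inv C hCdet]

theorem stmt1 (N L l : ℕ) (hL : 1 ≤ L) (hNL : L ≤ N) (hl1 : 1 ≤ l) (hlL : l ≤ L)
    (h g : Fin (L + 1) → ℂ) (a : Fin l → ℂ)
    (ha : Function.Injective a)
    (hrootsg : ∀ k, channelPoly L g (a k) = 0)
    (hnotrootsh : ∀ k, channelPoly L h (a k) ≠ 0) :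
    ∃ V₁ : Matrix (Fin (N + L)) (Fin l) ℂ,
      V₁ᴴ * V₁ = 1 ∧
      toeplitzChannel N L g * V₁ = 0 ∧
      (toeplitzChannel N L h * V₁).rank = l := by
  let W : Matrix (Fin (N + L)) (Fin l) ℂ := of fun j k => a k ^ (j : ℕ)
  have hTW (f : Fin (L + 1) → ℂ) (i : Fin N) (k : Fin l) :
      (toeplitzChannel N L f * W) i k = channelPoly L f (a k) * a k ^ (i : ℕ) :=
    sum_toeplitzChannel_mul_pow N L f (a k) i
  have hinj : Function.Injective (toeplitzChannel N L h * W).mulVecLin := by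
    refine (injective_iff_map_eq_zero _).mpr fun x hx => ?_
    have hv : (fun k => channelPoly L h (a k) * x k) = 0 := by
      refine eq_zero_of_forall_pow_sum_mul_pow_eq_zero ha fun i => ?_
      have hxi := congrFun hx ⟨i, by omega⟩
      simp only [mulVecLin_apply, mulVec, dotProduct, hTW, Pi.zero_apply] at hxi
      rw [← hxi]
      exact Finset.sum_congr rfl fun k _ => by ring
    funext k
    exact (mul_eq_zero.mp (congrFun hv k)).resolve_left (hnotrootsh k)
  have hWinj : Function.Injective W.mulVec := by
    refine Function.Injective.of_comp (f := (toeplitzChannel N L h).mulVec) ?_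
    convert hinj using 1
    funext x
    simp
  obtain ⟨B, hB, hWB⟩ := exists_isUnit_det_conjTranspose_mul_self_eq_one W hWinj
  refine ⟨W * B, hWB, ?_, ?_⟩
  · have hzero : toeplitzChannel N L g * W = 0 := by
      ext i k
      simp [hTW, hrootsg]
    rw [← Matrix.mul_assoc, hzero, Matrix.zero_mul]
  · rw [← Matrix.mul_assoc, rank_mul_eq_left_of_isUnit_det _ _ hB, rank,
      LinearMap.finrank_range_of_inj hinj, Module.finrank_fin_fun]
end

section
/- Let A, B ∈ ℂ^{n×n} be Hermitian positive semidefinite matrices. Then lim_{P → ∞} [ log det(I_n + P·(A+B)) − log det(I_n + P·B) ] / log(P) = rank(A+B) − rank(B), where both determinants are positive real numbers for P ≥ 0. -/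
open Matrix Filter ComplexOrder

theorem Matrix.IsHermitian.det_one_add_smul {n : Type*} [Fintype n] [DecidableEq n]
    {M : Matrix n n ℂ} (hM : M.IsHermitian) (P : ℝ) :
    (1 + (P : ℂ) • M).det = ((∏ i, (1 + P * hM.eigenvalues i) : ℝ) : ℂ) := by
  have hU : (hM.eigenvectorUnitary : Matrix n n ℂ) *
      star (hM.eigenvectorUnitary : Matrix n n ℂ) = 1 :=
    Unitary.coe_mul_star_self _
  have key : 1 + (P : ℂ) • M = (hM.eigenvectorUnitary : Matrix n n ℂ) *
      diagonal (fun i => ((1 + P * hM.eigenvalues i : ℝ) : ℂ)) *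
      star (hM.eigenvectorUnitary : Matrix n n ℂ) := by
    have hd : diagonal (fun i => ((1 + P * hM.eigenvalues i : ℝ) : ℂ)) =
        1 + (P : ℂ) • diagonal (RCLike.ofReal ∘ hM.eigenvalues : n → ℂ) := by
      rw [← diagonal_one, ← diagonal_smul, diagonal_add]
      congr 1
      ext i
      simp
    conv_lhs => rw [hM.spectral_theorem, Unitary.conjStarAlgAut_apply]
    rw [hd, mul_add, add_mul, mul_one, hU, mul_smul_comm, smul_mul_assoc]
  rw [key, det_mul_right_comm, hU, one_mul, det_diagonal]
  push_cast
  rfl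

theorem Matrix.PosSemidef.one_add_mul_eigenvalues_pos {n : Type*} [Fintype n] [DecidableEq n]
    {M : Matrix n n ℂ} (hM : M.PosSemidef) {P : ℝ} (hP : 0 ≤ P) (i : n) :
    0 < 1 + P * hM.isHermitian.eigenvalues i := by
  have := mul_nonneg hP (hM.eigenvalues_nonneg i)
  linarith

theorem Matrix.PosSemidef.det_one_add_smul_pos {n : Type*} [Fintype n] [DecidableEq n]
    {M : Matrix n n ℂ} (hM : M.PosSemidef) {P : ℝ} (hP : 0 ≤ P) :
    (1 + (P : ℂ) • M).det.im = 0 ∧ 0 < (1 + (P : ℂ) • M).det.re := by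
  rw [hM.isHermitian.det_one_add_smul, Complex.ofReal_im, Complex.ofReal_re]
  exact ⟨rfl, Finset.prod_pos fun i _ => hM.one_add_mul_eigenvalues_pos hP i⟩

theorem tendsto_log_one_add_mul_div_log {c : ℝ} (hc : 0 ≤ c) :
    Tendsto (fun P : ℝ => Real.log (1 + P * c) / Real.log P) atTop
      (nhds (if c ≠ 0 then 1 else 0)) := by
  rcases hc.eq_or_lt with rfl | hc
  · simp
  · rw [if_pos hc.ne']
    have h1 : Tendsto (fun P : ℝ => Real.log (P⁻¹ + c)) atTop (nhds (Real.log c)) := by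
      have h := (tendsto_inv_atTop_zero (𝕜 := ℝ)).add_const c
      rw [zero_add] at h
      exact h.log hc.ne'
    have h2 := (h1.div_atTop Real.tendsto_log_atTop).const_add 1
    rw [add_zero] at h2
    refine h2.congr' ?_
    filter_upwards [eventually_gt_atTop 1] with P hP
    have hP0 : 0 < P := by linarith
    have hlog : Real.log P ≠ 0 := (Real.log_pos hP).ne'
    have hfac : 1 + P * c = P * (P⁻¹ + c) := by field_simp
    rw [hfac, Real.log_mul hP0.ne' (by positivity), add_div, div_self hlog]

theorem Matrix.PosSemidef.tendsto_log_det_one_add_smul_div_log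
    {n : Type*} [Fintype n] [DecidableEq n] {M : Matrix n n ℂ} (hM : M.PosSemidef) :
    Tendsto (fun P : ℝ => Real.log ((1 + (P : ℂ) • M).det.re) / Real.log P) atTop
      (nhds (M.rank : ℝ)) := by
  have hrank : (M.rank : ℝ) =
      ∑ i, if hM.isHermitian.eigenvalues i ≠ 0 then (1 : ℝ) else 0 := by
    rw [hM.isHermitian.rank_eq_card_non_zero_eigs, Fintype.card_subtype, Finset.sum_boole]
  rw [hrank]
  refine (tendsto_finsetSum _ fun i _ =>
    tendsto_log_one_add_mul_div_log (hM.eigenvalues_nonneg i)).congr' ?_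
  filter_upwards [eventually_ge_atTop 0] with P hP
  rw [hM.isHermitian.det_one_add_smul, Complex.ofReal_re,
    Real.log_prod fun i _ => (hM.one_add_mul_eigenvalues_pos hP i).ne', Finset.sum_div]

theorem stmt5 (n : ℕ) (A B : Matrix (Fin n) (Fin n) ℂ)
    (hA : A.PosSemidef) (hB : B.PosSemidef) :
    (∀ P : ℝ, 0 ≤ P →
      ((1 + (P : ℂ) • (A + B)).det.im = 0 ∧ 0 < (1 + (P : ℂ) • (A + B)).det.re) ∧
      ((1 + (P : ℂ) • B).det.im = 0 ∧ 0 < (1 + (P : ℂ) • B).det.re)) ∧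
    Tendsto (fun P : ℝ =>
        (Real.log ((1 + (P : ℂ) • (A + B)).det.re) -
          Real.log ((1 + (P : ℂ) • B).det.re)) / Real.log P)
      atTop (nhds (((A + B).rank : ℝ) - (B.rank : ℝ))) := by
  refine ⟨fun P hP => ⟨(hA.add hB).det_one_add_smul_pos hP, hB.det_one_add_smul_pos hP⟩, ?_⟩
  simp only [sub_div]
  exact (hA.add hB).tendsto_log_det_one_add_smul_div_log.sub
    hB.tendsto_log_det_one_add_smul_div_log
end

section
/- Let H ∈ ℂ^{N×l} and let λ₁, ..., λ_l ≥ 0 be the eigenvalues (with multiplicity) of the Hermitian positive semidefinite matrix H^H H. Then for every P ≥ 0: sup{ log det(I_N + H S H^H) : S ∈ ℂ^{l×l} Hermitian positive semidefinite, tr(S) ≤ P } = max{ Σ_{i=1}^{l} log(1 + p_i λ_i) : p ∈ ℝ^l, p_i ≥ 0 for all i, Σ_{i=1}^{l} p_i ≤ P }. Moreover the supremum on the left is attained at S = U diag(p*) U^H, where the columns of U are orthonormal eigenvectors of H^H H ordered consistently with λ₁,...,λ_l and p* attains the maximum on the right. -/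
open Matrix ComplexOrder

/-- A positive semidefinite `n × n` matrix `A` satisfies `det A ≤ exp (tr A - n)`. -/
theorem Matrix.PosSemidef.det_re_le_exp_trace_sub_card {n : Type*} [Fintype n] [DecidableEq n]
    {A : Matrix n n ℂ} (hA : A.PosSemidef) :
    A.det.re ≤ Real.exp (A.trace.re - Fintype.card n) := by
  have htr : A.trace.re = ∑ i, hA.isHermitian.eigenvalues i := by
    rw [hA.isHermitian.trace_eq_sum_eigenvalues]
    simp
  have hdet : A.det.re = ∏ i, hA.isHermitian.eigenvalues i := by
    rw [hA.isHermitian.det_eq_prod_eigenvalues]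
    simp only [Complex.coe_algebraMap, ← Complex.ofReal_prod,
      Complex.ofReal_re]
  have hexp : A.trace.re - Fintype.card n = ∑ i, (hA.isHermitian.eigenvalues i - 1) := by
    rw [htr, Finset.sum_sub_distrib]
    simp
  rw [hdet, hexp, Real.exp_sum]
  refine Finset.prod_le_prod (fun i _ => hA.eigenvalues_nonneg i) fun i _ => ?_
  linarith [Real.add_one_le_exp (hA.isHermitian.eigenvalues i - 1)]

/-- **Hadamard's inequality** for positive definite matrices. -/
theorem Matrix.PosDef.det_re_le_prod_diag {n : Type*} [Fintype n] [DecidableEq n]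
    {A : Matrix n n ℂ} (hA : A.PosDef) : A.det.re ≤ ∏ i, (A i i).re := by
  have hpos (i : n) : 0 < (A i i).re := (Complex.pos_iff.mp hA.diag_pos).1
  have hreal (i : n) : A i i = ((A i i).re : ℂ) :=
    Complex.ext rfl (by simpa using (Complex.pos_iff.mp hA.diag_pos).2.symm)
  let d : n → ℝ := fun i => (√(A i i).re)⁻¹
  have hd (i : n) : d i * d i * (A i i).re = 1 := by
    simp only [d]
    rw [← mul_inv, Real.mul_self_sqrt (hpos i).le, inv_mul_cancel₀ (hpos i).ne']
  let D : Matrix n n ℂ := diagonal fun i => (d i : ℂ)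
  have hD : Dᴴ = D := by
    simp only [D, diagonal_conjTranspose]
    congr 1
    ext i
    simp
  have hB : (D * A * D).PosSemidef := by
    simpa only [hD] using hA.posSemidef.mul_mul_conjTranspose_same D
  have hBtr : (D * A * D).trace = (Fintype.card n : ℂ) := by
    have h (i : n) : (D * A * D) i i = 1 := by
      simp only [D, mul_diagonal, diagonal_mul]
      rw [hreal i]
      have := hd i
      norm_cast
      linarith
    simp [Matrix.trace, h]
  have hBdet : (D * A * D).det = ((∏ i, d i * d i : ℝ) : ℂ) * A.det := by
    simp only [D, det_mul, det_diagonal, Finset.prod_mul_distrib, Complex.ofReal_mul,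
      Complex.ofReal_prod]
    ring
  have key := hB.det_re_le_exp_trace_sub_card
  rw [hBtr, hBdet, Complex.re_ofReal_mul] at key
  simp only [Complex.natCast_re, sub_self, Real.exp_zero] at key
  have hprod : (∏ i, d i * d i) * ∏ i, (A i i).re = 1 := by
    rw [← Finset.prod_mul_distrib]
    exact Finset.prod_eq_one fun i _ => hd i
  have hPpos : 0 < ∏ i, (A i i).re := Finset.prod_pos fun i _ => hpos i
  have hdpos : 0 < ∏ i, d i * d i := pos_of_mul_pos_left (hprod ▸ one_pos) hPpos.le
  exact le_of_mul_le_mul_left (key.trans hprod.ge) hdpos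

/-- Diagonalising `Hᴴ * H` moves the Sylvester determinant to symmetric form. -/
theorem det_one_add_mul_mul_conjTranspose {m n : Type*} [Fintype m] [DecidableEq m] [Fintype n]
    [DecidableEq n] (H : Matrix m n ℂ) (lam : n → ℝ) (hlam : ∀ i, 0 ≤ lam i) (U : Matrix n n ℂ)
    (hspec : Hᴴ * H = U * diagonal (fun i => (lam i : ℂ)) * Uᴴ) (S : Matrix n n ℂ) :
    (1 + H * S * Hᴴ).det =
      (1 + diagonal (fun i => (√(lam i) : ℂ)) * (Uᴴ * S * U) *
        diagonal (fun i => (√(lam i) : ℂ))).det := by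
  have hsq : diagonal (fun i => (lam i : ℂ)) =
      diagonal (fun i => (√(lam i) : ℂ)) * diagonal (fun i => (√(lam i) : ℂ)) := by
    rw [diagonal_mul_diagonal]
    congr 1
    ext i
    rw [← Complex.ofReal_mul, Real.mul_self_sqrt (hlam i)]
  rw [Matrix.mul_assoc H, det_one_add_mul_comm, Matrix.mul_assoc S, hspec, hsq]
  set D := diagonal (fun i => (√(lam i) : ℂ))
  rw [show S * (U * (D * D) * Uᴴ) = (S * U * D) * (D * Uᴴ) by simp only [mul_assoc],
    det_one_add_mul_comm]
  simp only [mul_assoc]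

/-- The water-filling objective attains its maximum on the set of feasible power allocations. -/
theorem exists_isMaxOn_sum_log {n : Type*} [Fintype n] (lam : n → ℝ) (hlam : ∀ i, 0 ≤ lam i)
    {P : ℝ} (hP : 0 ≤ P) :
    ∃ p ∈ {q : n → ℝ | (∀ i, 0 ≤ q i) ∧ ∑ i, q i ≤ P},
      IsMaxOn (fun q : n → ℝ => ∑ i, Real.log (1 + q i * lam i))
        {q : n → ℝ | (∀ i, 0 ≤ q i) ∧ ∑ i, q i ≤ P} p := by
  have hclosed : IsClosed {q : n → ℝ | (∀ i, 0 ≤ q i) ∧ ∑ i, q i ≤ P} := by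
    rw [Set.ofPred_and, Set.ofPred_forall]
    exact (isClosed_iInter fun i => isClosed_le (by fun_prop) (by fun_prop)).inter
      (isClosed_le (by fun_prop) (by fun_prop))
  have hcompact : IsCompact {q : n → ℝ | (∀ i, 0 ≤ q i) ∧ ∑ i, q i ≤ P} := by
    refine (isCompact_Icc (a := (0 : n → ℝ)) (b := fun _ => P)).of_isClosed_subset hclosed ?_
    rintro q ⟨hq, hqP⟩
    exact ⟨hq, fun i =>
      (Finset.single_le_sum (fun j _ => hq j) (Finset.mem_univ i)).trans hqP⟩
  refine hcompact.exists_isMaxOn ⟨0, fun _ => le_rfl, by simpa using hP⟩ ?_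
  refine continuousOn_finsetSum _ fun i _ => ContinuousOn.log (by fun_prop) fun q hq => ?_
  have := mul_nonneg (hq.1 i) (hlam i)
  positivity

/-- The log-det of a transmit covariance is bounded by that of its diagonal in the eigenbasis. -/
theorem log_det_le_sum_log {m n : Type*} [Fintype m] [DecidableEq m] [Fintype n]
    [DecidableEq n] (H : Matrix m n ℂ) (lam : n → ℝ) (hlam : ∀ i, 0 ≤ lam i) (U : Matrix n n ℂ)
    (hspec : Hᴴ * H = U * diagonal (fun i => (lam i : ℂ)) * Uᴴ) {S : Matrix n n ℂ}
    (hS : S.PosSemidef) :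
    Real.log (1 + H * S * Hᴴ).det.re ≤
      ∑ i, Real.log (1 + ((Uᴴ * S * U) i i).re * lam i) := by
  have hT : (Uᴴ * S * U).PosSemidef := hS.conjTranspose_mul_mul_same U
  rw [det_one_add_mul_mul_conjTranspose H lam hlam U hspec]
  set D : Matrix n n ℂ := diagonal (fun i => (√(lam i) : ℂ)) with hDdef
  have hD : Dᴴ = D := by
    rw [hDdef, diagonal_conjTranspose]
    congr 1
    ext i
    simp
  have hA : (1 + D * (Uᴴ * S * U) * D).PosDef := by
    refine PosDef.one.add_posSemidef ?_
    simpa only [hD] using hT.mul_mul_conjTranspose_same D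
  have hdiag (i : n) : ((1 + D * (Uᴴ * S * U) * D) i i).re =
      1 + ((Uᴴ * S * U) i i).re * lam i := by
    rw [Matrix.add_apply, one_apply_eq, hDdef, mul_diagonal, diagonal_mul, Complex.add_re,
      Complex.re_mul_ofReal, Complex.re_ofReal_mul, Complex.one_re]
    linear_combination ((Uᴴ * S * U) i i).re * Real.mul_self_sqrt (hlam i)
  have hT0 (i : n) : 0 ≤ ((Uᴴ * S * U) i i).re := (Complex.nonneg_iff.mp hT.diag_nonneg).1
  rw [← Real.log_prod fun i _ => by have := mul_nonneg (hT0 i) (hlam i); positivity]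
  refine Real.log_le_log (Complex.pos_iff.mp hA.det_pos).1 ?_
  simpa only [hdiag] using hA.det_re_le_prod_diag

/-- A covariance that is diagonal in the eigenbasis decouples the channel. -/
theorem log_det_diagonal_eq_sum_log {m n : Type*} [Fintype m] [DecidableEq m] [Fintype n]
    [DecidableEq n] (H : Matrix m n ℂ) (lam : n → ℝ) (hlam : ∀ i, 0 ≤ lam i) (U : Matrix n n ℂ)
    (hU : Uᴴ * U = 1) (hspec : Hᴴ * H = U * diagonal (fun i => (lam i : ℂ)) * Uᴴ)
    {p : n → ℝ} (hp : ∀ i, 0 ≤ p i) :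
    Real.log (1 + H * (U * diagonal (fun i => (p i : ℂ)) * Uᴴ) * Hᴴ).det.re =
      ∑ i, Real.log (1 + p i * lam i) := by
  have hT : Uᴴ * (U * diagonal (fun i => (p i : ℂ)) * Uᴴ) * U =
      diagonal (fun i => (p i : ℂ)) := by
    rw [show Uᴴ * (U * diagonal (fun i => (p i : ℂ)) * Uᴴ) * U =
      (Uᴴ * U) * diagonal (fun i => (p i : ℂ)) * (Uᴴ * U) by simp only [mul_assoc], hU, one_mul,
      mul_one]
  have hentry (i : n) : (1 : ℂ) + √(lam i) * p i * √(lam i) = ((1 + p i * lam i : ℝ) : ℂ) := by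
    norm_cast
    linear_combination p i * Real.mul_self_sqrt (hlam i)
  rw [det_one_add_mul_mul_conjTranspose H lam hlam U hspec, hT, diagonal_mul_diagonal,
    diagonal_mul_diagonal, ← diagonal_one, diagonal_add, det_diagonal]
  simp only [hentry, ← Complex.ofReal_prod, Complex.ofReal_re]
  exact Real.log_prod fun i _ => by have := mul_nonneg (hp i) (hlam i); positivity



theorem stmt9 (N l : ℕ) (H : Matrix (Fin N) (Fin l) ℂ)
    (lam : Fin l → ℝ) (hlam : ∀ i, 0 ≤ lam i)
    (U : Matrix (Fin l) (Fin l) ℂ) (hU : Uᴴ * U = 1)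
    (hspec : Hᴴ * H = U * Matrix.diagonal (fun i => (lam i : ℂ)) * Uᴴ)
    (P : ℝ) (hP : 0 ≤ P) :
    ∃ p : Fin l → ℝ, (∀ i, 0 ≤ p i) ∧ (∑ i, p i) ≤ P ∧
      IsGreatest {r : ℝ | ∃ q : Fin l → ℝ, (∀ i, 0 ≤ q i) ∧ (∑ i, q i) ≤ P ∧
          r = ∑ i, Real.log (1 + q i * lam i)}
        (∑ i, Real.log (1 + p i * lam i)) ∧
      IsGreatest {r : ℝ | ∃ S : Matrix (Fin l) (Fin l) ℂ, S.PosSemidef ∧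
          (Matrix.trace S).re ≤ P ∧ r = Real.log ((1 + H * S * Hᴴ).det.re)}
        (Real.log ((1 + H * (U * Matrix.diagonal (fun i => (p i : ℂ)) * Uᴴ) * Hᴴ).det.re)) ∧
      Real.log ((1 + H * (U * Matrix.diagonal (fun i => (p i : ℂ)) * Uᴴ) * Hᴴ).det.re) =
        ∑ i, Real.log (1 + p i * lam i) := by
  obtain ⟨p, ⟨hp0, hpP⟩, hmax⟩ := exists_isMaxOn_sum_log lam hlam hP
  have hval := log_det_diagonal_eq_sum_log H lam hlam U hU hspec hp0
  have hU' : U * Uᴴ = 1 := mul_eq_one_comm.mp hU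
  refine ⟨p, hp0, hpP, ⟨⟨p, hp0, hpP, rfl⟩, ?_⟩, ⟨⟨_, ?_, ?_, rfl⟩, ?_⟩, hval⟩
  · rintro r ⟨q, hq0, hqP, rfl⟩
    exact hmax ⟨hq0, hqP⟩
  · exact (PosSemidef.diagonal fun i => by simpa using hp0 i).mul_mul_conjTranspose_same U
  · rw [trace_mul_comm, ← mul_assoc, hU, one_mul, trace_diagonal, ← Complex.ofReal_sum,
      Complex.ofReal_re]
    exact hpP
  · rintro r ⟨S, hS, hSP, rfl⟩
    rw [hval]
    have hT : (Uᴴ * S * U).PosSemidef := hS.conjTranspose_mul_mul_same U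
    refine (log_det_le_sum_log H lam hlam U hspec hS).trans
      (hmax ⟨fun i => (Complex.nonneg_iff.mp hT.diag_nonneg).1, ?_⟩)
    have htr : (Uᴴ * S * U).trace = S.trace := by
      rw [trace_mul_comm, ← mul_assoc, hU', one_mul]
    rw [← Complex.re_sum]
    exact (congrArg Complex.re htr).trans_le hSP
end

section
/- Let H ∈ ℂ^{N×l} with rank(H) = l ≥ 1, let λ₁, ..., λ_l > 0 be the eigenvalues of the Hermitian positive definite matrix H^H H, and let P̄ > 0. Then there exists a unique μ > 0 with Σ_{i=1}^{l} max(μ − 1/λ_i, 0) = P̄, and max{ log det(I_N + H S H^H) : S ∈ ℂ^{l×l} Hermitian positive semidefinite, tr(S) ≤ P̄ } = Σ_{i=1}^{l} max( log(μ λ_i), 0 ). -/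
open Matrix ComplexOrder

/-- A positive semidefinite matrix satisfies `det M ≤ exp (tr M - n)`. -/
theorem Matrix.PosSemidef.det_re_le_exp {n : ℕ} {M : Matrix (Fin n) (Fin n) ℂ}
    (hM : M.PosSemidef) : M.det.re ≤ Real.exp (M.trace.re - n) := by
  have hd : M.det.re = ∏ i, hM.1.eigenvalues i := by
    rw [hM.1.det_eq_prod_eigenvalues, ← Complex.ofReal_re (∏ i, hM.1.eigenvalues i)]
    push_cast
    rfl
  have ht : M.trace.re = ∑ i, hM.1.eigenvalues i := by
    rw [hM.1.trace_eq_sum_eigenvalues, ← Complex.ofReal_re (∑ i, hM.1.eigenvalues i)]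
    push_cast
    rfl
  have hsum : (∑ i, hM.1.eigenvalues i) - n = ∑ i, (hM.1.eigenvalues i - 1) := by
    simp
  rw [hd, ht, hsum, Real.exp_sum]
  refine Finset.prod_le_prod (fun i _ => hM.eigenvalues_nonneg i) fun i _ => ?_
  simpa using Real.add_one_le_exp (hM.1.eigenvalues i - 1)

/-- The determinant of `1 + diag(d) T diag(d)` is bounded through its diagonal, for any
positive weights `b`. -/
theorem det_one_add_diagonal_conj_re_le {n : ℕ} {T : Matrix (Fin n) (Fin n) ℂ}
    (hT : T.PosSemidef) (d b : Fin n → ℝ) (hb : ∀ i, 0 < b i) :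
    (1 + diagonal (fun i => (d i : ℂ)) * T * diagonal (fun i => (d i : ℂ))).det.re ≤
      (∏ i, b i) * Real.exp (∑ i, ((1 + d i ^ 2 * (T i i).re) / b i - 1)) := by
  set D : Matrix (Fin n) (Fin n) ℂ := diagonal (fun i => (d i : ℂ)) with hD
  set e : Fin n → ℝ := fun i => (Real.sqrt (b i))⁻¹ with he
  have hee : ∀ i, e i * e i = (b i)⁻¹ := fun i => by
    simp only [he]
    rw [← mul_inv, Real.mul_self_sqrt (hb i).le]
  set E : Matrix (Fin n) (Fin n) ℂ := diagonal (fun i => (e i : ℂ)) with hE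
  have hDH : Dᴴ = D := by
    rw [hD, diagonal_conjTranspose]; congr 1; ext i; simp
  have hEH : Eᴴ = E := by
    rw [hE, diagonal_conjTranspose]; congr 1; ext i; simp
  have hA : (1 + D * T * D).PosSemidef := by
    refine PosSemidef.one.add ?_
    simpa [hDH] using hT.mul_mul_conjTranspose_same D
  have hM : (E * (1 + D * T * D) * E).PosSemidef := by
    simpa [hEH] using hA.mul_mul_conjTranspose_same E
  have hdet : (E * (1 + D * T * D) * E).det.re = (∏ i, b i)⁻¹ * (1 + D * T * D).det.re := by
    have hE2 : E.det * E.det = (((∏ i, b i)⁻¹ : ℝ) : ℂ) := by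
      rw [hE, det_diagonal, ← Finset.prod_mul_distrib, ← Finset.prod_inv_distrib]
      push_cast
      refine Finset.prod_congr rfl fun i _ => ?_
      rw [← Complex.ofReal_mul, hee, Complex.ofReal_inv]
    rw [det_mul, det_mul, mul_right_comm, hE2, Complex.re_ofReal_mul]
  have htr : (E * (1 + D * T * D) * E).trace.re - n =
      ∑ i, ((1 + d i ^ 2 * (T i i).re) / b i - 1) := by
    have hentry : ∀ i, ((E * (1 + D * T * D) * E) i i).re = (1 + d i ^ 2 * (T i i).re) / b i := by
      intro i
      rw [hE, mul_diagonal, diagonal_mul, Matrix.add_apply, hD, mul_diagonal, diagonal_mul, one_apply_eq]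
      have : (e i : ℂ) * (1 + d i * T i i * d i) * e i =
          ((e i * e i : ℝ) : ℂ) * (1 + ((d i ^ 2 : ℝ) : ℂ) * T i i) := by
        push_cast; ring
      rw [this, Complex.re_ofReal_mul, Complex.add_re, Complex.re_ofReal_mul, hee, Complex.one_re]
      ring
    rw [trace, Complex.re_sum, Finset.sum_sub_distrib]
    simp [hentry]
  have h := hM.det_re_le_exp
  rw [hdet, htr] at h
  rwa [inv_mul_le_iff₀ (Finset.prod_pos fun i _ => hb i)] at h

theorem det_one_add_mul_mul_conjTranspose_s11 {N l : ℕ} (H : Matrix (Fin N) (Fin l) ℂ)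
    (U : Matrix (Fin l) (Fin l) ℂ) (D S : Matrix (Fin l) (Fin l) ℂ)
    (hspec : Hᴴ * H = U * (D * D) * Uᴴ) :
    (1 + H * S * Hᴴ).det = (1 + D * (Uᴴ * S * U) * D).det := by
  have h1 : (1 + H * S * Hᴴ).det = (1 + S * (Hᴴ * H)).det := by
    rw [Matrix.mul_assoc H, det_one_add_mul_comm, Matrix.mul_assoc]
  rw [h1, hspec, show S * (U * (D * D) * Uᴴ) = (S * U * D) * (D * Uᴴ) by
    simp only [Matrix.mul_assoc], det_one_add_mul_comm]
  simp only [Matrix.mul_assoc]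

/-- The water level exists and is unique. -/
theorem existsUnique_waterLevel {l : ℕ} (hl : 1 ≤ l) (c : Fin l → ℝ) (hc : ∀ i, 0 < c i)
    {P : ℝ} (hP : 0 < P) :
    ∃ μ : ℝ, 0 < μ ∧ (∑ i, max (μ - c i) 0) = P ∧
      ∀ μ' : ℝ, 0 < μ' → (∑ i, max (μ' - c i) 0) = P → μ' = μ := by
  set f : ℝ → ℝ := fun μ => ∑ i, max (μ - c i) 0 with hf
  have hlt : ∀ x y, x < y → f x = P → f y ≠ P := by
    intro x y hxy hx hy
    obtain ⟨i, -, hi⟩ : ∃ i ∈ Finset.univ, (0 : ℝ) < max (x - c i) 0 := by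
      by_contra! hcon
      exact absurd (hx ▸ Finset.sum_nonpos hcon : P ≤ 0) hP.not_ge
    have hxi : 0 < x - c i := by simpa using hi
    have : f x < f y := by
      refine Finset.sum_lt_sum (fun j _ => by gcongr) ⟨i, Finset.mem_univ i, ?_⟩
      rw [max_eq_left hxi.le]
      exact lt_max_of_lt_left (by linarith)
    linarith
  let i₀ : Fin l := ⟨0, hl⟩
  have hcont : Continuous f := by fun_prop
  have h0 : f 0 = 0 := Finset.sum_eq_zero fun i _ => max_eq_right (by linarith [hc i])
  have hbig : P ≤ f (P + c i₀) :=
    calc P ≤ max (P + c i₀ - c i₀) 0 := by simp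
      _ ≤ f (P + c i₀) := Finset.single_le_sum (f := fun i => max (P + c i₀ - c i) 0)
          (fun i _ => le_max_right _ _) (Finset.mem_univ i₀)
  obtain ⟨μ, hμ, hμP⟩ := intermediate_value_Icc (by linarith [hc i₀] : (0 : ℝ) ≤ P + c i₀)
    hcont.continuousOn (show P ∈ Set.Icc (f 0) (f (P + c i₀)) from ⟨by linarith, hbig⟩)
  refine ⟨μ, lt_of_le_of_ne hμ.1 ?_, hμP, fun μ' _ h' => ?_⟩
  · rintro rfl
    linarith
  · rcases lt_trichotomy μ' μ with h | h | h
    · exact absurd hμP (hlt _ _ h h')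
    · exact h
    · exact absurd h' (hlt _ _ h hμP)

theorem stmt11 (N l : ℕ) (hl : 1 ≤ l) (H : Matrix (Fin N) (Fin l) ℂ)
    (hrk : H.rank = l) (lam : Fin l → ℝ) (hlam : ∀ i, 0 < lam i)
    (U : Matrix (Fin l) (Fin l) ℂ) (hU : Uᴴ * U = 1)
    (hspec : Hᴴ * H = U * Matrix.diagonal (fun i => (lam i : ℂ)) * Uᴴ)
    (Pbar : ℝ) (hP : 0 < Pbar) :
    ∃ μ : ℝ, 0 < μ ∧
      (∑ i, max (μ - (lam i)⁻¹) 0) = Pbar ∧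
      (∀ μ' : ℝ, 0 < μ' → (∑ i, max (μ' - (lam i)⁻¹) 0) = Pbar → μ' = μ) ∧
      IsGreatest {r : ℝ | ∃ S : Matrix (Fin l) (Fin l) ℂ, S.PosSemidef ∧
          (Matrix.trace S).re ≤ Pbar ∧ r = Real.log ((1 + H * S * Hᴴ).det.re)}
        (∑ i, max (Real.log (μ * lam i)) 0) := by
  obtain ⟨μ, hμ, hμP, huniq⟩ :=
    existsUnique_waterLevel hl (fun i => (lam i)⁻¹) (fun i => inv_pos.2 (hlam i)) hP
  refine ⟨μ, hμ, hμP, huniq, ?_⟩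
  have hU' : U * Uᴴ = 1 := mul_eq_one_comm.1 hU
  set d : Fin l → ℝ := fun i => Real.sqrt (lam i) with hd
  have hd2 : ∀ i, d i ^ 2 = lam i := fun i => Real.sq_sqrt (hlam i).le
  set D : Matrix (Fin l) (Fin l) ℂ := diagonal (fun i => (d i : ℂ)) with hD
  have hDD : D * D = diagonal (fun i => (lam i : ℂ)) := by
    rw [hD, diagonal_mul_diagonal]
    congr 1
    ext i
    rw [← Complex.ofReal_mul, ← sq, hd2]
  rw [← hDD] at hspec
  have hpos : ∀ i, 0 < μ * lam i := fun i => mul_pos hμ (hlam i)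
  set b : Fin l → ℝ := fun i => max (μ * lam i) 1 with hb
  have hbpos : ∀ i, 0 < b i := fun i => lt_max_of_lt_right one_pos
  have hlogb : ∀ i, max (Real.log (μ * lam i)) 0 = Real.log (b i) := by
    intro i
    rcases le_total (μ * lam i) 1 with h | h
    · simp only [hb]
      rw [max_eq_right h, max_eq_right (Real.log_nonpos (hpos i).le h), Real.log_one]
    · simp only [hb]
      rw [max_eq_left h, max_eq_left (Real.log_nonneg h)]
  have hval : ∑ i, max (Real.log (μ * lam i)) 0 = Real.log (∏ i, b i) := by
    rw [Real.log_prod fun i _ => (hbpos i).ne']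
    exact Finset.sum_congr rfl fun i _ => hlogb i
  have hwater : ∀ i, b i = 1 + lam i * max (μ - (lam i)⁻¹) 0 := by
    intro i
    rw [mul_max_of_nonneg _ _ (hlam i).le, mul_sub, mul_inv_cancel₀ (hlam i).ne', mul_zero,
      ← max_add_add_left, add_sub_cancel, add_zero, mul_comm]
  rw [hval]
  constructor
  · set p : Fin l → ℝ := fun i => max (μ - (lam i)⁻¹) 0 with hp
    refine ⟨U * diagonal (fun i => (p i : ℂ)) * Uᴴ, ?_, ?_, ?_⟩
    · refine PosSemidef.mul_mul_conjTranspose_same (PosSemidef.diagonal fun i => ?_) U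
      exact Complex.zero_le_real.2 (le_max_right _ _)
    · rw [trace_mul_comm, ← Matrix.mul_assoc, hU, Matrix.one_mul, trace_diagonal,
        ← Complex.ofReal_sum, Complex.ofReal_re]
      exact hμP.le
    · have hT : Uᴴ * (U * diagonal (fun i => (p i : ℂ)) * Uᴴ) * U =
          diagonal (fun i => (p i : ℂ)) := by
        rw [← Matrix.mul_assoc, ← Matrix.mul_assoc, hU, Matrix.one_mul, Matrix.mul_assoc, hU,
          Matrix.mul_one]
      rw [det_one_add_mul_mul_conjTranspose_s11 H U D _ hspec, hT, hD, diagonal_mul_diagonal,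
        diagonal_mul_diagonal, ← diagonal_one, diagonal_add, det_diagonal]
      congr 1
      rw [← Complex.ofReal_re (∏ i, b i), Complex.ofReal_prod]
      congr 1
      refine Finset.prod_congr rfl fun i _ => ?_
      rw [show b i = 1 + d i ^ 2 * p i by rw [hwater, hd2]]
      push_cast
      ring
  · rintro r ⟨S, hS, htr, rfl⟩
    have hT : (Uᴴ * S * U).PosSemidef := hS.conjTranspose_mul_mul_same U
    have hdetpos : 0 < (1 + H * S * Hᴴ).det.re :=
      (Complex.pos_iff.1 (PosDef.one.add_posSemidef (hS.mul_mul_conjTranspose_same H)).det_pos).1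
    have hbound := det_one_add_diagonal_conj_re_le hT d b hbpos
    rw [← hD, ← det_one_add_mul_mul_conjTranspose_s11 H U D S hspec] at hbound
    refine Real.log_le_log hdetpos (hbound.trans ?_)
    have hTtr : ∑ i, ((Uᴴ * S * U) i i).re ≤ Pbar := by
      have : (Uᴴ * S * U).trace = S.trace := by
        rw [trace_mul_comm, ← Matrix.mul_assoc, hU', Matrix.one_mul]
      rw [← this, trace, Complex.re_sum] at htr
      exact htr
    have hexp : ∑ i, ((1 + d i ^ 2 * ((Uᴴ * S * U) i i).re) / b i - 1) ≤ 0 := by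
      have hterm : ∀ i, (1 + d i ^ 2 * ((Uᴴ * S * U) i i).re) / b i - 1 ≤
          (((Uᴴ * S * U) i i).re - max (μ - (lam i)⁻¹) 0) / μ := by
        intro i
        have ht : 0 ≤ ((Uᴴ * S * U) i i).re := (Complex.nonneg_iff.1 hT.diag_nonneg).1
        have hm : μ * lam i ≤ b i := le_max_left _ _
        rw [hd2, div_sub_one (hbpos i).ne', div_le_div_iff₀ (hbpos i) hμ]
        have hcomp : max (μ - (lam i)⁻¹) 0 * (b i - μ * lam i) = 0 := by
          rcases le_total (μ * lam i) 1 with h | h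
          · rw [max_eq_right, zero_mul]
            rw [sub_nonpos, ← one_div, le_div_iff₀ (hlam i)]
            exact h
          · simp only [hb]
            rw [max_eq_left h, sub_self, mul_zero]
        nlinarith [mul_nonneg ht (sub_nonneg.2 hm), hwater i]
      calc _ ≤ ∑ i, (((Uᴴ * S * U) i i).re - max (μ - (lam i)⁻¹) 0) / μ :=
            Finset.sum_le_sum fun i _ => hterm i
        _ = (∑ i, ((Uᴴ * S * U) i i).re - Pbar) / μ := by
            rw [← Finset.sum_div, Finset.sum_sub_distrib, hμP]
        _ ≤ 0 := div_nonpos_of_nonpos_of_nonneg (by linarith) hμ.le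
    exact mul_le_of_le_one_right (Finset.prod_pos fun i _ => hbpos i).le
      (Real.exp_le_one_iff.2 hexp)
end

section
/- Let N ≥ L ≥ 1, let K ≥ 1, and let g, h₁, ..., h_K ∈ ℂ^{L+1}. Suppose the polynomial S_g has L pairwise distinct complex roots, none of which is a root of any of the polynomials S_{h_1}, ..., S_{h_K}. Let l₁, ..., l_K be nonnegative integers with Σ_{k=1}^{K} l_k ≤ L. Then there exist matrices V_k ∈ ℂ^{(N+L)×l_k} for k = 1, ..., K such that the Σ_{k=1}^{K} l_k columns of the concatenated matrix [V₁, ..., V_K] are orthonormal, T(g) V_k = 0_{N×l_k} for every k, and for every k ∈ {1, ..., K} and every subset 𝒦 ⊆ {1, ..., K}: rank( T(h_k) ( Σ_{j∈𝒦} V_j V_j^H ) T(h_k)^H ) = Σ_{j∈𝒦} l_j. -/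
open Matrix

/-- A geometric progression is mapped to a multiple of itself, the factor being `S_h(z)`. -/
theorem toeplitzChannel_mulVec_pow (N L : ℕ) (h : Fin (L + 1) → ℂ) (z : ℂ) (r : Fin N) :
    (toeplitzChannel N L h *ᵥ fun j => z ^ (j : ℕ)) r = channelPoly L h z * z ^ (r : ℕ) := by
  rw [Matrix.mulVec, dotProduct, channelPoly, Finset.sum_mul]
  symm
  refine Finset.sum_of_injOn (fun i : Fin (L + 1) => (⟨r + (L - i), by omega⟩ : Fin (N + L)))
    ?_ (by simp) ?_ ?_
  · intro i _ j _ hij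
    simp only [Fin.mk.injEq] at hij
    ext
    omega
  · intro j _ hj
    have : ¬ ((r : ℕ) ≤ j ∧ (j : ℕ) - r ≤ L) := by
      intro hrj
      refine hj ⟨⟨L - (j - r), by omega⟩, by simp, ?_⟩
      ext
      simp only
      omega
    rw [toeplitzChannel, Matrix.of_apply, dif_neg this, zero_mul]
  · intro i _
    have hi : L - (L - (i : ℕ)) = i := by omega
    simp only [toeplitzChannel, Matrix.of_apply]
    rw [dif_pos (by omega)]
    simp only [add_tsub_cancel_left, hi, pow_add]
    ring

theorem eq_zero_of_forall_sum_mul_pow_eq_zero {L M : ℕ} (hLM : L ≤ M) {a : Fin L → ℂ}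
    (ha : Function.Injective a) {c : Fin L → ℂ}
    (hc : ∀ j : Fin M, ∑ i, c i * a i ^ (j : ℕ) = 0) : c = 0 :=
  Matrix.eq_zero_of_forall_pow_sum_mul_pow_eq_zero ha fun j => hc (Fin.castLE hLM j)

theorem toeplitzChannel_mulVec_sum_pow (N L : ℕ) (h : Fin (L + 1) → ℂ) (a c : Fin L → ℂ)
    (r : Fin N) :
    (toeplitzChannel N L h *ᵥ fun j => ∑ i, c i * a i ^ (j : ℕ)) r =
      ∑ i, c i * channelPoly L h (a i) * a i ^ (r : ℕ) := by
  have : (fun j : Fin (N + L) => ∑ i, c i * a i ^ (j : ℕ)) =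
      ∑ i, c i • fun j : Fin (N + L) => a i ^ (j : ℕ) := by
    ext j
    simp
  rw [this, Matrix.mulVec_sum, Finset.sum_apply]
  refine Finset.sum_congr rfl fun i _ => ?_
  rw [Matrix.mulVec_smul, Pi.smul_apply, toeplitzChannel_mulVec_pow, smul_eq_mul, mul_assoc]

/-- The span of the columns of a transposed Vandermonde matrix with distinct nodes has an
orthonormal basis, written as the product of that matrix with a matrix of coefficients. -/
theorem exists_orthonormal_vandermonde_mul {L M : ℕ} (hLM : L ≤ M) {a : Fin L → ℂ}
    (ha : Function.Injective a) :
    ∃ C : Matrix (Fin L) (Fin L) ℂ,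
      ((Matrix.of fun (j : Fin M) i => a i ^ (j : ℕ)) * C)ᴴ *
        ((Matrix.of fun (j : Fin M) i => a i ^ (j : ℕ)) * C) = 1 := by
  let v : Fin L → EuclideanSpace ℂ (Fin M) := fun i => WithLp.toLp 2 fun j => a i ^ (j : ℕ)
  have hv : LinearIndependent ℂ v := by
    rw [Fintype.linearIndependent_iff]
    intro c hc
    refine congrFun (eq_zero_of_forall_sum_mul_pow_eq_zero hLM ha fun j => ?_)
    simpa [v] using congrArg (fun x : EuclideanSpace ℂ (Fin M) => x j) hc
  have hcard : Module.finrank ℂ (Submodule.span ℂ (Set.range v)) = L := by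
    simpa using finrank_span_eq_card hv
  let b := (stdOrthonormalBasis ℂ (Submodule.span ℂ (Set.range v))).reindex (finCongr hcard)
  choose c hc using fun i => (Submodule.mem_span_range_iff_exists_fun ℂ).1 (b i).2
  have hentry : ∀ j i, ((Matrix.of fun (j : Fin M) i => a i ^ (j : ℕ)) *
      (Matrix.of fun m i => c i m)) j i = (b i : EuclideanSpace ℂ (Fin M)) j := by
    intro j i
    rw [← hc i]
    simp [Matrix.mul_apply, v, mul_comm]
  refine ⟨Matrix.of fun m i => c i m, ?_⟩
  ext p q
  have hb := orthonormal_iff_ite.1 b.orthonormal p q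
  rw [Matrix.mul_apply, Matrix.one_apply, ← hb, Submodule.coe_inner, PiLp.inner_apply]
  refine Finset.sum_congr rfl fun j _ => ?_
  rw [Matrix.conjTranspose_apply, hentry, hentry, RCLike.inner_apply, mul_comm]
  rfl

theorem Matrix.mulVec_injective_of_conjTranspose_mul_self_eq_one {m n : Type*} [Fintype m]
    [Fintype n] [DecidableEq n] {U : Matrix m n ℂ} (hU : Uᴴ * U = 1) :
    Function.Injective U.mulVec := by
  intro x y hxy
  simpa [Matrix.mulVec_mulVec, hU] using congrArg (Uᴴ *ᵥ ·) hxy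

open scoped ComplexOrder in
theorem Matrix.rank_mul_conjTranspose_of_mulVec_injective {m n : Type*} [Fintype m] [Fintype n]
    {U : Matrix m n ℂ} (hU : Function.Injective U.mulVec) : (U * Uᴴ).rank = Fintype.card n := by
  rw [Matrix.rank_self_mul_conjTranspose, Matrix.rank,
    LinearMap.finrank_range_of_inj (f := U.mulVecLin) hU, Module.finrank_fintype_fun_eq_card]

theorem stmt12 (N L K : ℕ) (hL : 1 ≤ L) (hNL : L ≤ N) (hK : 1 ≤ K)
    (g : Fin (L + 1) → ℂ) (h : Fin K → Fin (L + 1) → ℂ)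
    (a : Fin L → ℂ) (ha : Function.Injective a)
    (hrootsg : ∀ i, channelPoly L g (a i) = 0)
    (hnotrootsh : ∀ (k : Fin K) (i : Fin L), channelPoly L (h k) (a i) ≠ 0)
    (l : Fin K → ℕ) (hl : (∑ k, l k) ≤ L) :
    ∃ V : (k : Fin K) → Matrix (Fin (N + L)) (Fin (l k)) ℂ,
      (∀ k, (V k)ᴴ * V k = 1) ∧
      (∀ j k, j ≠ k → (V j)ᴴ * V k = 0) ∧
      (∀ k, toeplitzChannel N L g * V k = 0) ∧
      (∀ (k : Fin K) (𝒦 : Finset (Fin K)),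
        (toeplitzChannel N L (h k) * (∑ j ∈ 𝒦, V j * (V j)ᴴ) *
          (toeplitzChannel N L (h k))ᴴ).rank = ∑ j ∈ 𝒦, l j) := by
  obtain ⟨C, hC⟩ := exists_orthonormal_vandermonde_mul (le_add_self : L ≤ N + L) ha
  set A : Matrix (Fin (N + L)) (Fin L) ℂ := Matrix.of fun j i => a i ^ (j : ℕ) with hA
  have hAmul : ∀ c, A *ᵥ c = fun j : Fin (N + L) => ∑ i, c i * a i ^ (j : ℕ) := by
    intro c
    ext j
    simp [hA, Matrix.mulVec, dotProduct, mul_comm]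
  have hTg : toeplitzChannel N L g * A = 0 := by
    ext r i
    have := toeplitzChannel_mulVec_pow N L g (a i) r
    rw [hrootsg, zero_mul] at this
    exact this
  have hTh : ∀ k, Function.Injective (toeplitzChannel N L (h k) * A).mulVec := by
    intro k
    refine (injective_iff_map_eq_zero (toeplitzChannel N L (h k) * A).mulVecLin).2 fun c hc => ?_
    rw [Matrix.mulVecLin_apply, ← Matrix.mulVec_mulVec, hAmul] at hc
    have := eq_zero_of_forall_sum_mul_pow_eq_zero hNL ha fun r => by
      rw [← toeplitzChannel_mulVec_sum_pow, hc, Pi.zero_apply]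
    ext i
    exact (mul_eq_zero.1 (congrFun this i)).resolve_right (hnotrootsh k i)
  obtain ⟨e⟩ : Nonempty ((Σ k, Fin (l k)) ↪ Fin L) :=
    Function.Embedding.nonempty_of_card_le (by simpa using hl)
  have hsub : ∀ {p q : Type} (f : p → Fin L) (f' : q → Fin L),
      ((A * C).submatrix id f)ᴴ * (A * C).submatrix id f' =
        (1 : Matrix (Fin L) (Fin L) ℂ).submatrix f f' := by
    intro p q f f'
    rw [← hC, Matrix.conjTranspose_submatrix,
      Matrix.submatrix_mul _ _ f id f' Function.bijective_id]
  refine ⟨fun k => (A * C).submatrix id fun c => e ⟨k, c⟩, fun k => ?_, fun j k hjk => ?_,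
    fun k => ?_, fun k 𝒦 => ?_⟩
  · rw [hsub]
    exact Matrix.submatrix_one _ (e.injective.comp sigma_mk_injective)
  · rw [hsub]
    ext x y
    simp [hjk]
  · change (toeplitzChannel N L g * (A * C)).submatrix id _ = _
    rw [← Matrix.mul_assoc, hTg, Matrix.zero_mul]
    rfl
  · let f : (Σ j : 𝒦, Fin (l j)) → Fin L := fun p => e ⟨p.1, p.2⟩
    have hf : Function.Injective f := by
      refine e.injective.comp ?_
      rintro ⟨⟨i, hi⟩, x⟩ ⟨⟨j, hj⟩, y⟩ hxy
      simp only [Sigma.mk.injEq] at hxy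
      obtain ⟨rfl, hxy⟩ := hxy
      cases hxy
      rfl
    let D := C.submatrix id f
    have hD : (A * C).submatrix id f = A * D :=
      Matrix.submatrix_mul A C id id f Function.bijective_id
    have hsum : (∑ j ∈ 𝒦, ((A * C).submatrix id fun c => e ⟨j, c⟩) *
        ((A * C).submatrix id fun c => e ⟨j, c⟩)ᴴ) = (A * D) * (A * D)ᴴ := by
      rw [← hD]
      ext x y
      rw [Matrix.sum_apply, Matrix.mul_apply, Fintype.sum_sigma, ← Finset.sum_coe_sort 𝒦]
      rfl
    have hAD : Function.Injective (A * D).mulVec := by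
      apply Matrix.mulVec_injective_of_conjTranspose_mul_self_eq_one
      rw [← hD, hsub, Matrix.submatrix_one _ hf]
    have hDinj : Function.Injective D.mulVec := by
      refine Function.Injective.of_comp (f := A.mulVec) ?_
      simpa [Function.comp_def, Matrix.mulVec_mulVec] using hAD
    have hTAD : Function.Injective (toeplitzChannel N L (h k) * A * D).mulVec := by
      simpa [Function.comp_def, Matrix.mulVec_mulVec] using (hTh k).comp hDinj
    have := Matrix.rank_mul_conjTranspose_of_mulVec_injective hTAD
    rw [hsum]
    simpa [Matrix.mul_assoc, Finset.sum_coe_sort 𝒦 l, Finset.sum_attach 𝒦 l] using this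
end

section
/- Let N ≥ L ≥ 1 and let h₁, h₂ ∈ ℂ^{L+1}. Suppose the polynomials S_{h₁} and S_{h₂} each have L pairwise distinct complex roots and have no common root. Then for all integers l₁, l₂ with 0 ≤ l₁ ≤ L and 0 ≤ l₂ ≤ L there exist matrices V₁ ∈ ℂ^{(N+L)×l₁} and V₂ ∈ ℂ^{(N+L)×l₂}, each with orthonormal columns, such that T(h₂) V₁ = 0_{N×l₁}, T(h₁) V₂ = 0_{N×l₂}, rank(T(h₁) V₁) = l₁, and rank(T(h₂) V₂) = l₂. -/
open Matrix

open scoped MatrixOrder ComplexOrder in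
/-- Orthonormalization: a complex matrix with injective `mulVec` can be right-multiplied by an
invertible matrix so that its columns become orthonormal. -/
theorem exists_isUnit_det_orthonormal_mul {m n : Type*} [Fintype m] [Fintype n] [DecidableEq n]
    (W : Matrix m n ℂ) (hW : Function.Injective W.mulVec) :
    ∃ C : Matrix n n ℂ, IsUnit C.det ∧ (W * C)ᴴ * (W * C) = 1 := by
  have hpos : (Wᴴ * W).PosDef := PosDef.conjTranspose_mul_self W hW
  obtain ⟨B, hB⟩ := CStarAlgebra.nonneg_iff_eq_star_mul_self.mp hpos.posSemidef.nonneg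
  rw [star_eq_conjTranspose] at hB
  have hBu : IsUnit B.det := by
    have hdet := hpos.det_pos.ne'
    rw [hB, det_mul] at hdet
    exact (right_ne_zero_of_mul hdet).isUnit
  refine ⟨B⁻¹, (isUnit_nonsing_inv_det_iff).mpr hBu, ?_⟩
  calc (W * B⁻¹)ᴴ * (W * B⁻¹) = (B⁻¹)ᴴ * (Wᴴ * W) * B⁻¹ := by
        simp only [conjTranspose_mul, Matrix.mul_assoc]
    _ = (B * B⁻¹)ᴴ * (B * B⁻¹) := by
        rw [hB]
        simp only [conjTranspose_mul, Matrix.mul_assoc]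
    _ = 1 := by simp [mul_nonsing_inv B hBu]

theorem rank_eq_of_mulVec_injective {K : Type*} [Field K] {m : Type*} {l : ℕ} [Fintype m]
    (A : Matrix m (Fin l) K) (hA : Function.Injective A.mulVec) : A.rank = l := by
  rw [Matrix.rank, LinearMap.finrank_range_of_inj (f := A.mulVecLin) hA]
  simp

/-- Geometric sequences are eigenvectors of the channel, up to truncation. -/
theorem toeplitzChannel_mul_pow (N L : ℕ) (h : Fin (L + 1) → ℂ) {ι : Type*} (z : ι → ℂ)
    (i : Fin N) (k : ι) :
    (toeplitzChannel N L h * Matrix.of fun (j : Fin (N + L)) k => z k ^ (j : ℕ)) i k =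
      channelPoly L h (z k) * z k ^ (i : ℕ) := by
  simp only [mul_apply, channelPoly, Finset.sum_mul, toeplitzChannel, of_apply]
  symm
  refine Finset.sum_of_injOn (fun d : Fin (L + 1) => ⟨i + (L - d), by omega⟩) ?_ ?_ ?_ ?_
  · intro d _ e _ hde
    simp only [Fin.mk.injEq] at hde
    ext
    omega
  · simp
  · intro j _ hj
    rw [dif_neg, zero_mul]
    rintro ⟨hij, hjL⟩
    refine hj ⟨⟨L - (j - i), by omega⟩, by simp, ?_⟩
    ext
    simp only
    omega
  · intro d _
    rw [dif_pos ⟨by simp, by simp⟩, mul_assoc, ← pow_add, add_comm]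
    congr 2
    ext
    simp only
    omega

/-- The secret precoder for one user: it is nulled by the channel `g`, and it is received with full
rank through any channel `h` that does not vanish at the given roots of `channelPoly L g`. -/
theorem exists_orthonormal_precoder (N L l : ℕ) (hlN : l ≤ N) (g h : Fin (L + 1) → ℂ)
    (z : Fin l → ℂ) (hz : Function.Injective z) (hg : ∀ k, channelPoly L g (z k) = 0)
    (hh : ∀ k, channelPoly L h (z k) ≠ 0) :
    ∃ V : Matrix (Fin (N + L)) (Fin l) ℂ,
      Vᴴ * V = 1 ∧ toeplitzChannel N L g * V = 0 ∧ (toeplitzChannel N L h * V).rank = l := by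
  set W : Matrix (Fin (N + L)) (Fin l) ℂ := Matrix.of fun j k => z k ^ (j : ℕ) with hWdef
  have hgW : toeplitzChannel N L g * W = 0 := by
    ext i k
    rw [toeplitzChannel_mul_pow, hg, zero_mul, Matrix.zero_apply]
  have hinj : Function.Injective (toeplitzChannel N L h * W).mulVec := by
    rw [← coe_mulVecLin, ← LinearMap.ker_eq_bot, LinearMap.ker_eq_bot']
    intro x hx
    have hcx : (fun k => channelPoly L h (z k) * x k) = 0 := by
      refine eq_zero_of_forall_pow_sum_mul_pow_eq_zero hz fun i => ?_
      have hi := congrFun hx (Fin.castLE hlN i)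
      simp only [mulVecLin_apply, mulVec, dotProduct, Pi.zero_apply, hWdef,
        toeplitzChannel_mul_pow, Fin.val_castLE] at hi
      rw [← hi]
      exact Finset.sum_congr rfl fun k _ => by ring
    ext k
    exact (mul_eq_zero.mp (congrFun hcx k)).resolve_left (hh k)
  have hWinj : Function.Injective W.mulVec := by
    intro x y hxy
    apply hinj
    simp only [← mulVec_mulVec, hxy]
  obtain ⟨C, hC, horth⟩ := exists_isUnit_det_orthonormal_mul W hWinj
  refine ⟨W * C, horth, ?_, ?_⟩
  · rw [← Matrix.mul_assoc, hgW, Matrix.zero_mul]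
  · rw [← Matrix.mul_assoc, rank_mul_eq_left_of_isUnit_det C _ hC,
      rank_eq_of_mulVec_injective _ hinj]

theorem stmt13 (N L : ℕ) (hL : 1 ≤ L) (hNL : L ≤ N)
    (h₁ h₂ : Fin (L + 1) → ℂ)
    (a b : Fin L → ℂ) (ha : Function.Injective a) (hb : Function.Injective b)
    (hroots₁ : ∀ i, channelPoly L h₁ (a i) = 0)
    (hroots₂ : ∀ i, channelPoly L h₂ (b i) = 0)
    (hnocommon : ∀ z : ℂ, ¬(channelPoly L h₁ z = 0 ∧ channelPoly L h₂ z = 0)) :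
    ∀ l₁ l₂ : ℕ, l₁ ≤ L → l₂ ≤ L →
      ∃ (V₁ : Matrix (Fin (N + L)) (Fin l₁) ℂ)
        (V₂ : Matrix (Fin (N + L)) (Fin l₂) ℂ),
        V₁ᴴ * V₁ = 1 ∧ V₂ᴴ * V₂ = 1 ∧
        toeplitzChannel N L h₂ * V₁ = 0 ∧
        toeplitzChannel N L h₁ * V₂ = 0 ∧
        (toeplitzChannel N L h₁ * V₁).rank = l₁ ∧
        (toeplitzChannel N L h₂ * V₂).rank = l₂ := by
  intro l₁ l₂ hl₁ hl₂
  obtain ⟨V₁, ho₁, hn₁, hr₁⟩ := exists_orthonormal_precoder N L l₁ (hl₁.trans hNL) h₂ h₁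
    (b ∘ Fin.castLE hl₁) (hb.comp (Fin.castLE_injective hl₁)) (fun _ => hroots₂ _)
    (fun _ h => hnocommon _ ⟨h, hroots₂ _⟩)
  obtain ⟨V₂, ho₂, hn₂, hr₂⟩ := exists_orthonormal_precoder N L l₂ (hl₂.trans hNL) h₁ h₂
    (a ∘ Fin.castLE hl₂) (ha.comp (Fin.castLE_injective hl₂)) (fun _ => hroots₁ _)
    (fun _ h => hnocommon _ ⟨hroots₁ _, h⟩)
  exact ⟨V₁, V₂, ho₁, ho₂, hn₁, hn₂, hr₁, hr₂⟩
end

section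
/- Let A ∈ ℂ^{n×m} and let V₀ ∈ ℂ^{m×k₀}, V₁ ∈ ℂ^{m×k₁}, V₂ ∈ ℂ^{m×k₂} be matrices such that A · V₂ = 0_{n×k₂} and the columns of V₀, V₁, V₂ together span all of ℂ^m. Then rank( A (V₀ V₀^H + V₁ V₁^H) A^H ) = rank(A). -/
open Matrix

theorem stmt14 (n m k₀ k₁ k₂ : ℕ) (A : Matrix (Fin n) (Fin m) ℂ)
    (V₀ : Matrix (Fin m) (Fin k₀) ℂ) (V₁ : Matrix (Fin m) (Fin k₁) ℂ)
    (V₂ : Matrix (Fin m) (Fin k₂) ℂ)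
    (hAV₂ : A * V₂ = 0)
    (hspan : Submodule.span ℂ
        ((Set.range fun (j : Fin k₀) (i : Fin m) => V₀ i j) ∪
         (Set.range fun (j : Fin k₁) (i : Fin m) => V₁ i j) ∪
         (Set.range fun (j : Fin k₂) (i : Fin m) => V₂ i j)) =
      (⊤ : Submodule ℂ (Fin m → ℂ))) :
    (A * (V₀ * V₀ᴴ + V₁ * V₁ᴴ) * Aᴴ).rank = A.rank := by
  set W := fromCols V₀ V₁ with hW
  have hfac : A * (V₀ * V₀ᴴ + V₁ * V₁ᴴ) * Aᴴ = (A * W) * (A * W)ᴴ := by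
    rw [conjTranspose_mul, Matrix.mul_assoc A W, ← Matrix.mul_assoc W, hW,
      conjTranspose_fromCols_eq_fromRows_conjTranspose, fromCols_mul_fromRows, Matrix.mul_assoc]
  have hspan_le : (⊤ : Submodule ℂ (Fin m → ℂ)) ≤
      (LinearMap.range (A * W).mulVecLin).comap A.mulVecLin := by
    rw [← hspan, Submodule.span_le]
    rintro _ ((⟨j, rfl⟩ | ⟨j, rfl⟩) | ⟨j, rfl⟩)
    · refine ⟨Pi.single (Sum.inl j) 1, ?_⟩
      rw [mulVecLin_apply, mulVecLin_apply, ← mulVec_mulVec, mulVec_single_one]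
      rfl
    · refine ⟨Pi.single (Sum.inr j) 1, ?_⟩
      rw [mulVecLin_apply, mulVecLin_apply, ← mulVec_mulVec, mulVec_single_one]
      rfl
    · refine ⟨0, ?_⟩
      rw [map_zero, mulVecLin_apply]
      exact funext fun i => (congrFun (congrFun hAV₂ i) j).symm
  open scoped ComplexOrder in rw [hfac, rank_self_mul_conjTranspose]
  refine le_antisymm (rank_mul_le_left A W) (Submodule.finrank_mono ?_)
  rintro _ ⟨x, rfl⟩
  exact hspan_le (Submodule.mem_top (x := x))
end
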